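/- (Siegel) For every ε > 0 there exists a constant c(ε) > 0 such that for every integer Q ≥ 3 and every primitive real-valued Dirichlet character χ modulo Q, every real zero β of the Dirichlet L-function L(s,χ) satisfies β < 1 − c(ε)/Q^ε. -/

import Mathlib

open Filter Topology Set MeasureTheory

namespace DirichletCharacter

variable {N : ℕ} [NeZero N]

lemma sum_range_modulus_eq_zero {χ : DirichletCharacter ℂ N} (hχ : χ ≠ 1) :
    ∑ k ∈ Finset.range N, χ k = 0 := by
  rw [← MulChar.sum_eq_zero_of_ne_one hχ]
  refine Finset.sum_bij' (fun k _ ↦ (k : ZMod N)) (fun a _ ↦ a.val) ?_ ?_ ?_ ?_ ?_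
  · simp
  · intro a _
    simpa using ZMod.val_lt a
  · intro k hk
    exact ZMod.val_cast_of_lt (Finset.mem_range.mp hk)
  · simp
  · simp

lemma norm_sum_range_le_modulus {χ : DirichletCharacter ℂ N} (hχ : χ ≠ 1) (n : ℕ) :
    ‖∑ k ∈ Finset.range n, χ k‖ ≤ N := by
  induction n using Nat.strong_induction_on with
  | _ n ih =>
    rcases le_total n N with h | h
    · calc ‖∑ k ∈ Finset.range n, χ k‖ ≤ ∑ k ∈ Finset.range n, (1 : ℝ) :=
            norm_sum_le_of_le _ fun k _ ↦ χ.norm_le_one _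
        _ ≤ N := by simpa using h
    · obtain ⟨m, rfl⟩ := Nat.exists_eq_add_of_le h
      rw [Finset.sum_range_add, sum_range_modulus_eq_zero hχ]
      simpa using ih m (by have := NeZero.pos N; omega)

lemma norm_sum_Icc_le_modulus {χ : DirichletCharacter ℂ N} (hχ : χ ≠ 1) (n : ℕ) :
    ‖∑ k ∈ Finset.Icc 1 n, χ k‖ ≤ N := by
  have hN : N ≠ 1 := fun h ↦ hχ (level_one' χ h)
  have := norm_sum_range_le_modulus hχ (n + 1)
  rwa [Finset.range_eq_Ico, Finset.sum_eq_sum_Ico_succ_bot (by omega), Nat.cast_zero,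
    χ.map_zero' hN, zero_add] at this

omit [NeZero N] in
lemma norm_sum_Icc_le (χ : DirichletCharacter ℂ N) (n : ℕ) :
    ‖∑ k ∈ Finset.Icc 1 n, χ k‖ ≤ n :=
  calc ‖∑ k ∈ Finset.Icc 1 n, χ k‖ ≤ ∑ k ∈ Finset.Icc 1 n, (1 : ℝ) :=
        norm_sum_le_of_le _ fun k _ ↦ χ.norm_le_one _
    _ = n := by simp

lemma norm_sum_Icc_floor_le_rpow {χ : DirichletCharacter ℂ N} (hχ : χ ≠ 1) {θ : ℝ}
    (hθ₀ : 0 ≤ θ) (hθ₁ : θ ≤ 1) {t : ℝ} (ht : 0 ≤ t) :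
    ‖∑ k ∈ Finset.Icc 1 ⌊t⌋₊, χ k‖ ≤ (N : ℝ) ^ θ * t ^ (1 - θ) := by
  set A := ‖∑ k ∈ Finset.Icc 1 ⌊t⌋₊, χ k‖ with hA
  have hA₀ : 0 ≤ A := norm_nonneg _
  calc A = A ^ (θ + (1 - θ)) := by simp
    _ = A ^ θ * A ^ (1 - θ) := Real.rpow_add_of_nonneg hA₀ hθ₀ (by linarith)
    _ ≤ (N : ℝ) ^ θ * t ^ (1 - θ) := by
      gcongr
      · exact norm_sum_Icc_le_modulus hχ _
      · exact (norm_sum_Icc_le χ _).trans (Nat.floor_le ht)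

/-- The summatory function of a nontrivial Dirichlet character, cut off to `(1, ∞)`. -/
noncomputable def summatory (χ : DirichletCharacter ℂ N) : ℝ → ℂ :=
  (Ioi 1).indicator fun t ↦ ∑ k ∈ Finset.Icc 1 ⌊t⌋₊, χ k

lemma norm_summatory_le (χ : DirichletCharacter ℂ N) (hχ : χ ≠ 1) (t : ℝ) :
    ‖χ.summatory t‖ ≤ N := by
  unfold summatory
  by_cases ht : t ∈ Ioi (1 : ℝ)
  · simpa [ht] using norm_sum_Icc_le_modulus hχ _
  · simp [ht]

lemma differentiableAt_mellin_summatory {χ : DirichletCharacter ℂ N} (hχ : χ ≠ 1) {s : ℂ}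
    (hs : s.re < 0) : DifferentiableAt ℂ (mellin χ.summatory) s := by
  refine mellin_differentiableAt_of_isBigO_rpow (a := 0) (b := s.re - 1) ?_ ?_ hs ?_ (by simp)
  · refine LocallyIntegrable.locallyIntegrableOn ?_ _
    refine (locallyIntegrable_const (N : ℝ)).mono ?_ (ae_of_all _ fun t ↦ ?_)
    · refine Measurable.aestronglyMeasurable (Measurable.indicator ?_ measurableSet_Ioi)
      exact (measurable_from_nat (f := fun n ↦ ∑ k ∈ Finset.Icc 1 n, χ k)).comp Nat.measurable_floor
    · simpa using norm_summatory_le χ hχ t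
  · refine Asymptotics.IsBigO.of_bound N (Eventually.of_forall fun t ↦ ?_)
    simpa using norm_summatory_le χ hχ t
  · refine Asymptotics.IsBigO.of_bound 0 ?_
    filter_upwards [Ioo_mem_nhdsGT (zero_lt_one (α := ℝ))] with t ht
    simp [summatory, not_lt.mpr ht.2.le]

omit [NeZero N] in
lemma mellin_summatory (χ : DirichletCharacter ℂ N) (s : ℂ) :
    mellin χ.summatory (-s) =
      ∫ t in Ioi (1 : ℝ), (∑ k ∈ Finset.Icc 1 ⌊t⌋₊, χ k) * (t : ℂ) ^ (-(s + 1)) := by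
  have h (t : ℝ) : (t : ℂ) ^ (-s - 1) • χ.summatory t = (Ioi (1 : ℝ)).indicator
      (fun t : ℝ ↦ (∑ k ∈ Finset.Icc 1 ⌊t⌋₊, χ k) * (t : ℂ) ^ (-(s + 1))) t := by
    unfold summatory
    by_cases ht : t ∈ Ioi (1 : ℝ)
    · simp only [ht, indicator_of_mem, smul_eq_mul, mul_comm]
      congr 2
      ring
    · simp [ht]
  rw [mellin]
  simp_rw [h]
  rw [setIntegral_indicator measurableSet_Ioi, inter_eq_right.mpr (Ioi_subset_Ioi zero_le_one)]

/-- Integral representation of `L(s, χ)` in the half plane `0 < re s`. -/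
lemma LFunction_eq_mul_mellin_summatory {χ : DirichletCharacter ℂ N} (hχ : χ ≠ 1) {s : ℂ}
    (hs : 0 < s.re) : LFunction χ s = s * mellin χ.summatory (-s) := by
  have hU : IsOpen {z : ℂ | 0 < z.re} := isOpen_lt continuous_const Complex.continuous_re
  have hf : AnalyticOnNhd ℂ (LFunction χ) {z : ℂ | 0 < z.re} :=
    (differentiable_LFunction hχ).differentiableOn.analyticOnNhd hU
  have hg : AnalyticOnNhd ℂ (fun s ↦ s * mellin χ.summatory (-s)) {z : ℂ | 0 < z.re} := by
    refine DifferentiableOn.analyticOnNhd (fun z hz ↦ DifferentiableAt.differentiableWithinAt ?_) hU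
    refine differentiableAt_id.mul ?_
    have hz' : (-z).re < 0 := by simpa using hz
    exact (differentiableAt_mellin_summatory hχ hz').comp (f := fun z ↦ -z) z differentiableAt_id.neg
  refine hf.eqOn_of_preconnected_of_eventuallyEq hg
    (convex_halfSpace_re_gt 0).isPreconnected (show (2 : ℂ) ∈ _ by simp) ?_ hs
  filter_upwards [(isOpen_lt continuous_const Complex.continuous_re).mem_nhds
    (show (1 : ℝ) < (2 : ℂ).re by simp)] with z hz
  have hz : 1 < z.re := hz
  rw [LFunction_eq_LSeries χ hz, LSeries_eq_mul_integral (r := 0) _ le_rfl (by linarith)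
    (LSeriesSummable_of_one_lt_re χ hz), mellin_summatory]
  refine Asymptotics.IsBigO.of_bound N (Eventually.of_forall fun n ↦ ?_)
  simpa using norm_sum_Icc_le_modulus hχ n

lemma norm_LFunction_le {χ : DirichletCharacter ℂ N} (hχ : χ ≠ 1) {δ : ℝ} (hδ₀ : 0 < δ)
    (hδ : δ ≤ 1 / 2) {s : ℂ} (hs : 1 - δ ≤ s.re) :
    ‖LFunction χ s‖ ≤ ‖s‖ * ((N : ℝ) ^ (2 * δ) / δ) := by
  rw [LFunction_eq_mul_mellin_summatory hχ (by linarith), norm_mul, mellin_summatory]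
  gcongr
  have hint : IntegrableOn (fun t : ℝ ↦ (N : ℝ) ^ (2 * δ) * t ^ (-1 - δ)) (Ioi 1) :=
    (integrableOn_Ioi_rpow_of_lt (by linarith) one_pos).const_mul _
  calc _ ≤ ∫ t in Ioi (1 : ℝ), (N : ℝ) ^ (2 * δ) * t ^ (-1 - δ) := by
        refine norm_integral_le_of_norm_le hint
          ((ae_restrict_iff' measurableSet_Ioi).mpr (ae_of_all _ fun t ht ↦ ?_))
        have ht : 1 < t := ht
        rw [norm_mul, Complex.norm_cpow_eq_rpow_re_of_pos (by linarith)]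
        calc _ ≤ ((N : ℝ) ^ (2 * δ) * t ^ (1 - 2 * δ)) * t ^ (-(1 - δ + 1)) := by
              gcongr
              · exact norm_sum_Icc_floor_le_rpow hχ (by linarith) (by linarith) (by linarith)
              · exact ht.le
              · simp only [Complex.neg_re, Complex.add_re, Complex.one_re]
                linarith
          _ = _ := by
              rw [mul_assoc, ← Real.rpow_add (by linarith)]
              ring_nf
    _ = (N : ℝ) ^ (2 * δ) / δ := by
        rw [integral_const_mul, integral_Ioi_rpow_of_lt (by linarith) one_pos]
        have : -1 - δ + 1 = -δ := by ring
        rw [this, Real.one_rpow]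
        field_simp

end DirichletCharacter

namespace DirichletCharacter

variable {N : ℕ} [NeZero N]
open ArithmeticFunction
open scoped ComplexOrder

omit [NeZero N]

lemma zetaMul_prime_pow (χ : DirichletCharacter ℂ N) {p : ℕ} (hp : p.Prime) (k : ℕ) :
    zetaMul χ (p ^ k) = ∑ i ∈ Finset.range (k + 1), χ p ^ i := by
  rw [zetaMul, coe_zeta_mul_apply, Nat.sum_divisors_prime_pow hp]
  refine Finset.sum_congr rfl fun i _ ↦ ?_
  rw [← apply_eq_toArithmeticFunction_apply χ (pow_ne_zero i hp.ne_zero)]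
  simp

/-- The coefficients of the Dirichlet series `ζ(s) L(s, χ) L(s, ψ) L(s, χψ)`. -/
noncomputable def biquadraticMul (χ ψ : DirichletCharacter ℂ N) : ArithmeticFunction ℂ :=
  zetaMul χ * (toArithmeticFunction (ψ ·) * toArithmeticFunction ((χ * ψ) ·))

lemma biquadraticMul_comm (χ ψ : DirichletCharacter ℂ N) :
    biquadraticMul χ ψ = biquadraticMul ψ χ := by
  rw [biquadraticMul, biquadraticMul, zetaMul, zetaMul, mul_comm ψ χ]
  ring

lemma isMultiplicative_biquadraticMul (χ ψ : DirichletCharacter ℂ N) :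
    (biquadraticMul χ ψ).IsMultiplicative :=
  χ.isMultiplicative_zetaMul.mul <| (isMultiplicative_toArithmeticFunction ψ).mul
    (isMultiplicative_toArithmeticFunction (χ * ψ))

lemma toArithmeticFunction_mul_eq_pmul_zetaMul (χ ψ : DirichletCharacter ℂ N) :
    toArithmeticFunction (ψ ·) * toArithmeticFunction ((χ * ψ) ·) =
      pmul (toArithmeticFunction (ψ ·)) (zetaMul χ) := by
  ext n
  rw [pmul_apply, zetaMul, mul_apply, mul_apply, Finset.mul_sum]
  refine Finset.sum_congr rfl fun x hx ↦ ?_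
  obtain ⟨h, hn⟩ := Nat.mem_divisorsAntidiagonal.mp hx
  have h₁ : x.1 ≠ 0 := fun h' ↦ hn (by simp [← h, h'])
  have h₂ : x.2 ≠ 0 := fun h' ↦ hn (by simp [← h, h'])
  rw [← apply_eq_toArithmeticFunction_apply _ h₁, ← apply_eq_toArithmeticFunction_apply _ h₂,
    ← apply_eq_toArithmeticFunction_apply _ h₂, ← apply_eq_toArithmeticFunction_apply _ hn, ← h]
  simp [h₁]
  ring

lemma biquadraticMul_prime_pow_nonneg_aux {χ ψ : DirichletCharacter ℂ N} (hχ : χ ^ 2 = 1)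
    {p : ℕ} (hp : p.Prime) (h : ∀ j, 0 ≤ ψ p ^ j * zetaMul χ (p ^ j)) (k : ℕ) :
    0 ≤ biquadraticMul χ ψ (p ^ k) := by
  rw [biquadraticMul, toArithmeticFunction_mul_eq_pmul_zetaMul, mul_apply]
  refine Finset.sum_nonneg fun x hx ↦ mul_nonneg (zetaMul_nonneg hχ _) ?_
  obtain ⟨j, -, hj⟩ := (Nat.dvd_prime_pow hp).mp
    ((Dvd.intro_left _ rfl).trans (Nat.mem_divisorsAntidiagonal.mp hx).1.dvd : x.2 ∣ p ^ k)
  rw [pmul_apply, hj, ← apply_eq_toArithmeticFunction_apply _ (pow_ne_zero j hp.ne_zero)]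
  simpa using h j

lemma biquadraticMul_prime_pow_nonneg {χ ψ : DirichletCharacter ℂ N} (hχ : χ ^ 2 = 1)
    (hψ : ψ ^ 2 = 1) {p : ℕ} (hp : p.Prime) (k : ℕ) :
    0 ≤ biquadraticMul χ ψ (p ^ k) := by
  have key {χ ψ : DirichletCharacter ℂ N} (hχ : χ ^ 2 = 1) (h : 0 ≤ ψ p) :
      0 ≤ biquadraticMul χ ψ (p ^ k) :=
    biquadraticMul_prime_pow_nonneg_aux hχ hp
      (fun j ↦ mul_nonneg (pow_nonneg h j) (zetaMul_nonneg hχ _)) k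
  rcases MulChar.isQuadratic_iff_sq_eq_one.mpr hψ p with h | h | h
  · exact key hχ h.ge
  · exact key hχ (h ▸ zero_le_one)
  rcases MulChar.isQuadratic_iff_sq_eq_one.mpr hχ p with h' | h' | h'
  · exact biquadraticMul_comm χ ψ ▸ key hψ h'.ge
  · exact biquadraticMul_comm χ ψ ▸ key hψ (h' ▸ zero_le_one)
  · refine biquadraticMul_prime_pow_nonneg_aux hχ hp (fun j ↦ ?_) k
    rw [zetaMul_prime_pow χ hp, h, h', neg_one_geom_sum]
    rcases Nat.even_or_odd j with hj | hj
    · simp [hj, Nat.even_add_one]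
    · simp [hj.add_one]

lemma biquadraticMul_nonneg {χ ψ : DirichletCharacter ℂ N} (hχ : χ ^ 2 = 1) (hψ : ψ ^ 2 = 1)
    (n : ℕ) : 0 ≤ biquadraticMul χ ψ n := by
  rcases eq_or_ne n 0 with rfl | hn
  · simp
  · rw [(isMultiplicative_biquadraticMul χ ψ).multiplicative_factorization _ hn]
    exact Finset.prod_nonneg fun p hp ↦
      biquadraticMul_prime_pow_nonneg hχ hψ (Nat.prime_of_mem_primeFactors hp) _

variable [NeZero N]

lemma LSeriesHasSum_toArithmeticFunction (χ : DirichletCharacter ℂ N) {s : ℂ} (hs : 1 < s.re) :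
    LSeriesHasSum (toArithmeticFunction (χ ·)) s (LFunction χ s) := by
  rw [LFunction_eq_LSeries χ hs, ← LSeriesHasSum_congr s _ (f := (χ ·))
    (fun hn ↦ apply_eq_toArithmeticFunction_apply χ hn)]
  exact (LSeriesSummable_of_one_lt_re χ hs).LSeriesHasSum

lemma LSeriesHasSum_biquadraticMul (χ ψ : DirichletCharacter ℂ N) {s : ℂ} (hs : 1 < s.re) :
    LSeriesHasSum (biquadraticMul χ ψ) s
      (riemannZeta s * LFunction χ s * (LFunction ψ s * LFunction (χ * ψ) s)) := by
  refine LSeriesHasSum_mul (LSeriesHasSum_mul ?_ (LSeriesHasSum_toArithmeticFunction χ hs)) <|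
    LSeriesHasSum_mul (LSeriesHasSum_toArithmeticFunction ψ hs)
      (LSeriesHasSum_toArithmeticFunction (χ * ψ) hs)
  simpa using! LSeriesHasSum_zeta hs

lemma abscissaOfAbsConv_biquadraticMul_lt (χ ψ : DirichletCharacter ℂ N) :
    LSeries.abscissaOfAbsConv (biquadraticMul χ ψ) < (2 : ℝ) := by
  refine ((LSeriesHasSum_biquadraticMul χ ψ (s := (3 / 2 : ℝ))
    (by norm_num)).LSeriesSummable.abscissaOfAbsConv_le).trans_lt ?_
  rw [Complex.ofReal_re, EReal.coe_lt_coe_iff]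
  norm_num

lemma one_le_re_LSeries_biquadraticMul {χ ψ : DirichletCharacter ℂ N} (hχ : χ ^ 2 = 1)
    (hψ : ψ ^ 2 = 1) : 1 ≤ (LSeries (biquadraticMul χ ψ) 2).re := by
  have hs := (LSeriesHasSum_biquadraticMul χ ψ (s := 2) (by norm_num))
  have h := Complex.hasSum_re hs
  rw [hs.LSeries_eq]
  refine le_trans ?_ (le_hasSum h 1 fun n _ ↦ ?_)
  · simp [LSeries.term, (isMultiplicative_biquadraticMul χ ψ).map_one]
  · have := LSeries.term_nonneg (biquadraticMul_nonneg hχ hψ n) 2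
    exact_mod_cast (Complex.le_def.mp this).1

end DirichletCharacter

open scoped ComplexOrder in
/-- Estermann's lemma. -/
lemma one_sub_le_of_dslope_bound_aux {W : ℂ → ℂ} (hW : Differentiable ℂ W)
    {a : ArithmeticFunction ℂ} (ha : ∀ n, 0 ≤ a n)
    (habs : LSeries.abscissaOfAbsConv a < (2 : ℝ)) (ha₂ : 1 ≤ (LSeries a 2).re)
    (hWa : ∀ s : ℂ, 1 < s.re → W s = (s - 1) * LSeries a s) {B : ℝ}
    (hB : ∀ z ∈ Metric.sphere (2 : ℂ) (3 / 2), ‖dslope W 1 z‖ ≤ B) {σ : ℝ}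
    (hσ : 7 / 8 ≤ σ) (hσ₁ : σ < 1) (hWσ : W σ = 0) {M : ℕ} (hM : M ≠ 0)
    (hMB : 8 * B * (3 / 4) ^ M ≤ 1) :
    1 - σ ≤ 2 * (W 1).re * (2 - σ) ^ M := by
  set G := dslope W 1 with hGdef
  set ℓ := (W 1).re with hℓ
  have hG : Differentiable ℂ G := by
    rw [← differentiableOn_univ] at hW ⊢
    exact (Complex.differentiableOn_dslope Filter.univ_mem).mpr hW
  have hBpos : 0 ≤ B := (norm_nonneg _).trans (hB (2 + (3 / 2 : ℝ)) (by simp))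
  have hLG : LSeries a =ᶠ[𝓝 2] fun s ↦ G s + W 1 * (1 * s - 1)⁻¹ := by
    filter_upwards [(isOpen_lt continuous_const Complex.continuous_re).mem_nhds
      (show (1 : ℝ) < (2 : ℂ).re by simp)] with z hz
    have hz : 1 < z.re := hz
    have h1 : z ≠ 1 := fun h ↦ by simp [h] at hz
    have h2 : z - 1 ≠ 0 := sub_ne_zero.mpr h1
    rw [hGdef, dslope_of_ne _ h1, slope_def_field, hWa z hz]
    field_simp
    ring
  have hLG₀ : LSeries a 2 = G 2 + W 1 := by
    rw [hLG.self_of_nhds]; norm_num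
  have hder (m : ℕ) : (-1) ^ m * iteratedDeriv m (LSeries a) 2 =
      (-1) ^ m * iteratedDeriv m G 2 + m.factorial * W 1 := by
    have hc : ContDiffAt ℂ m (fun s : ℂ ↦ (1 * s - 1)⁻¹) 2 :=
      ((contDiffAt_const.mul contDiffAt_id).sub contDiffAt_const).inv (by norm_num)
    rw [hLG.iteratedDeriv_eq, iteratedDeriv_fun_add hG.contDiff.contDiffAt (contDiffAt_const.mul hc),
      iteratedDeriv_const_mul _ hc, iteratedDeriv_eq_iterate (f := fun s : ℂ ↦ (1 * s - 1)⁻¹),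
      iter_deriv_inv_linear_sub]
    have : ((-1 : ℂ) ^ m) * (-1) ^ m = 1 := by rw [← mul_pow]; simp
    norm_num
    linear_combination (W 1 * m.factorial) * this
  set c : ℕ → ℝ := fun m ↦ ((m.factorial : ℂ)⁻¹ * ((-1) ^ m * iteratedDeriv m G 2)).re with hc
  have hc_ge (m : ℕ) : -ℓ ≤ c m := by
    have h0 : 0 ≤ (m.factorial : ℂ)⁻¹ * ((-1) ^ m * iteratedDeriv m (LSeries a) 2) :=
      mul_nonneg (by positivity)
        (by exact_mod_cast ArithmeticFunction.iteratedDeriv_LSeries_alternating a ha habs m)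
    have h1 := (Complex.le_def.mp h0).1
    rw [hder, mul_add, inv_mul_cancel_left₀ (by positivity), Complex.add_re] at h1
    simp only [Complex.zero_re] at h1
    linarith
  have hc_zero : 1 - ℓ ≤ c 0 := by
    have h : (LSeries a 2).re = (G 2).re + ℓ := by rw [hLG₀, Complex.add_re]
    have : c 0 = (G 2).re := by simp [hc]
    linarith
  have hc_abs (m : ℕ) : |c m| ≤ B * (2 / 3) ^ m := by
    refine (Complex.abs_re_le_norm _).trans ?_
    have := Complex.norm_iteratedDeriv_le_of_forall_mem_sphere_norm_le m (by norm_num)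
      (hG.diffContOnCl (s := Metric.ball 2 (3 / 2))) hB
    simp only [norm_mul, norm_inv, Complex.norm_natCast, norm_pow, norm_neg, norm_one, one_pow,
      one_mul]
    rw [inv_mul_le_iff₀ (by positivity)]
    refine this.trans (le_of_eq ?_)
    rw [show (2 / 3 : ℝ) = (3 / 2)⁻¹ by norm_num, inv_pow]
    ring
  set x := 2 - σ with hx
  have hsum : HasSum (fun m ↦ c m * x ^ m) (ℓ / (1 - σ)) := by
    have h := Complex.hasSum_re (Complex.hasSum_taylorSeries_of_entire hG 2 (σ : ℂ))
    have hne : (σ : ℂ) ≠ 1 := by exact_mod_cast hσ₁.ne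
    have hGσ : G σ = W 1 * ((1 - σ : ℝ) : ℂ)⁻¹ := by
      have : (σ : ℂ) - 1 ≠ 0 := sub_ne_zero.mpr hne
      have : (1 : ℂ) - σ ≠ 0 := sub_ne_zero.mpr hne.symm
      rw [hGdef, dslope_of_ne _ hne, slope_def_field, hWσ]
      push_cast
      field_simp
      ring
    rw [hGσ, ← Complex.ofReal_inv, Complex.re_mul_ofReal, ← div_eq_mul_inv] at h
    refine h.congr_fun ?_
    intro m
    simp only [hc]
    rw [← Complex.re_mul_ofReal]
    congr 1
    have : ((σ : ℂ) - 2) = (-1) * (x : ℂ) := by rw [hx]; push_cast; ring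
    rw [this, mul_pow]
    simp only [smul_eq_mul]
    push_cast
    ring
  have hx₁ : 1 < x := by linarith
  have hx₂ : x ≤ 9 / 8 := by linarith
  have hxσ : 1 - σ = x - 1 := by linarith
  have htail_le (m : ℕ) : -(B * (3 / 4) ^ m) ≤ c m * x ^ m := by
    have : |c m * x ^ m| ≤ B * (3 / 4) ^ m := by
      rw [abs_mul, abs_of_pos (show 0 < x ^ m by positivity)]
      calc |c m| * x ^ m ≤ (B * (2 / 3) ^ m) * (9 / 8) ^ m := by
            gcongr
            exact hc_abs m
        _ = B * (3 / 4) ^ m := by rw [mul_assoc, ← mul_pow]; norm_num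
    exact (abs_le.mp this).1
  have hgeom : HasSum (fun i ↦ -(B * (3 / 4 : ℝ) ^ (i + M))) (-(4 * B * (3 / 4) ^ M)) := by
    have := ((hasSum_geometric_of_lt_one (r := (3 / 4 : ℝ)) (by norm_num)
      (by norm_num)).mul_left (-(B * (3 / 4) ^ M)))
    rw [show -(B * (3 / 4) ^ M) * (1 - 3 / 4)⁻¹ = -(4 * B * (3 / 4) ^ M) by norm_num; ring] at this
    exact this.congr_fun fun i ↦ by ring
  have htail : -(4 * B * (3 / 4) ^ M) ≤ ∑' i, c (i + M) * x ^ (i + M) :=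
    hasSum_le (fun i ↦ htail_le (i + M)) hgeom
      ((summable_nat_add_iff M).mpr hsum.summable).hasSum
  have hhead : 1 - ℓ * ∑ m ∈ Finset.range M, x ^ m ≤ ∑ m ∈ Finset.range M, c m * x ^ m := by
    obtain ⟨k, rfl⟩ := Nat.exists_eq_succ_of_ne_zero hM
    rw [Finset.sum_range_succ', Finset.sum_range_succ', mul_add, Finset.mul_sum]
    have : ∑ i ∈ Finset.range k, -(ℓ * x ^ (i + 1)) ≤ ∑ i ∈ Finset.range k, c (i + 1) * x ^ (i + 1) :=
      Finset.sum_le_sum fun i _ ↦ by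
        have := mul_le_mul_of_nonneg_right (hc_ge (i + 1)) (show 0 ≤ x ^ (i + 1) by positivity)
        linarith
    rw [Finset.sum_neg_distrib] at this
    simp only [pow_zero, mul_one]
    linarith
  have htot := hsum.summable.sum_add_tsum_nat_add M
  rw [hsum.tsum_eq, hxσ] at htot
  rw [geom_sum_eq hx₁.ne'] at hhead
  have hxpos : 0 < x - 1 := by linarith
  have hfin : 1 / 2 ≤ ℓ / (x - 1) + ℓ * ((x ^ M - 1) / (x - 1)) := by linarith
  have heq : ℓ / (x - 1) + ℓ * ((x ^ M - 1) / (x - 1)) = ℓ * x ^ M / (x - 1) := by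
    field_simp
    ring
  rw [heq, le_div_iff₀ hxpos] at hfin
  linarith

open scoped ComplexOrder in
lemma one_sub_le_of_dslope_bound {W : ℂ → ℂ} (hW : Differentiable ℂ W)
    {a : ArithmeticFunction ℂ} (ha : ∀ n, 0 ≤ a n)
    (habs : LSeries.abscissaOfAbsConv a < (2 : ℝ)) (ha₂ : 1 ≤ (LSeries a 2).re)
    (hWa : ∀ s : ℂ, 1 < s.re → W s = (s - 1) * LSeries a s) {B : ℝ} (hB₁ : 1 ≤ B)
    (hB : ∀ z ∈ Metric.sphere (2 : ℂ) (3 / 2), ‖dslope W 1 z‖ ≤ B) {σ : ℝ}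
    (hσ : 7 / 8 ≤ σ) (hσ₁ : σ < 1) (hWσ : W σ = 0) :
    1 - σ ≤ 6 * (8 * B) ^ (4 * (1 - σ)) * ‖W 1‖ := by
  have hlog : 0 < Real.log (8 * B) := Real.log_pos (by linarith)
  set M := ⌈4 * Real.log (8 * B)⌉₊ with hM
  have hM₁ : 4 * Real.log (8 * B) ≤ M := Nat.le_ceil _
  have hM₂ : (M : ℝ) ≤ 4 * Real.log (8 * B) + 1 := (Nat.ceil_lt_add_one (by positivity)).le
  have hM₀ : M ≠ 0 := (Nat.ceil_pos.mpr (by positivity)).ne'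
  have hMB : 8 * B * (3 / 4) ^ M ≤ 1 := by
    have h34 : (3 / 4 : ℝ) ≤ Real.exp (-(1 / 4)) := by
      linarith [Real.add_one_le_exp (-(1 / 4 : ℝ))]
    calc 8 * B * (3 / 4) ^ M ≤ Real.exp (Real.log (8 * B)) * Real.exp (-(1 / 4)) ^ M := by
          rw [Real.exp_log (by positivity)]
          gcongr
      _ = Real.exp (Real.log (8 * B) - M / 4) := by
          rw [← Real.exp_nat_mul, ← Real.exp_add]
          ring_nf
      _ ≤ 1 := Real.exp_le_one_iff.mpr (by linarith)
  have h := one_sub_le_of_dslope_bound_aux hW ha habs ha₂ hWa hB hσ hσ₁ hWσ hM₀ hMB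
  have hpow : (2 - σ) ^ M ≤ 3 * (8 * B) ^ (4 * (1 - σ)) := by
    calc (2 - σ) ^ M ≤ Real.exp (1 - σ) ^ M := by
          gcongr
          · linarith
          · linarith [Real.add_one_le_exp (1 - σ)]
      _ = Real.exp ((1 - σ) * M) := by rw [← Real.exp_nat_mul, mul_comm]
      _ ≤ Real.exp (1 + Real.log (8 * B) * (4 * (1 - σ))) := by
          gcongr
          nlinarith
      _ = Real.exp 1 * (8 * B) ^ (4 * (1 - σ)) := by
          rw [Real.exp_add, Real.rpow_def_of_pos (by positivity)]
      _ ≤ _ := by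
          gcongr
          linarith [Real.exp_one_lt_d9]
  calc 1 - σ ≤ 2 * (W 1).re * (2 - σ) ^ M := h
    _ ≤ 2 * ‖W 1‖ * (3 * (8 * B) ^ (4 * (1 - σ))) := by
        gcongr
        · exact pow_nonneg (by linarith) _
        · exact Complex.re_le_norm _
    _ = _ := by ring
namespace DirichletCharacter

variable {N : ℕ} [NeZero N]

lemma exists_one_sub_zero_le : ∃ C : ℝ, 0 < C ∧ ∀ (N : ℕ) [NeZero N] (χ ψ : DirichletCharacter ℂ N),
    χ ^ 2 = 1 → ψ ^ 2 = 1 → χ ≠ 1 → ψ ≠ 1 → χ * ψ ≠ 1 → ∀ σ : ℝ, 7 / 8 ≤ σ → σ < 1 →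
    LFunction χ σ = 0 → 1 - σ ≤ C * (N : ℝ) ^ (12 * (1 - σ)) *
      (‖LFunction χ 1‖ * ‖LFunction ψ 1‖ * ‖LFunction (χ * ψ) 1‖) := by
  obtain ⟨K, hK⟩ := (isCompact_sphere (2 : ℂ) (3 / 2)).exists_bound_of_continuousOn
    (differentiable_LFunctionTrivChar₁ 1).continuous.continuousOn
  have hK₀ : 0 ≤ K := (norm_nonneg _).trans (hK (2 + (3 / 2 : ℝ)) (by simp))
  set D : ℝ := 8 * (2 * (K + 1) * 343) with hD
  have hD₁ : 1 ≤ D := by linarith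
  refine ⟨6 * D, by positivity, fun N _ χ ψ hχ hψ hχ₁ hψ₁ hχψ σ hσ hσ₁ hzero ↦ ?_⟩
  have hN : (1 : ℝ) ≤ N := by exact_mod_cast NeZero.one_le
  set W : ℂ → ℂ := fun s ↦ LFunctionTrivChar₁ 1 s *
    (LFunction χ s * (LFunction ψ s * LFunction (χ * ψ) s)) with hWdef
  have hW : Differentiable ℂ W :=
    (differentiable_LFunctionTrivChar₁ 1).mul <| (differentiable_LFunction hχ₁).mul <|
      (differentiable_LFunction hψ₁).mul (differentiable_LFunction hχψ)
  have hW₁ : W 1 = LFunction χ 1 * (LFunction ψ 1 * LFunction (χ * ψ) 1) := by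
    simp [hWdef]
  have hWa (s : ℂ) (hs : 1 < s.re) : W s = (s - 1) * LSeries (biquadraticMul χ ψ) s := by
    have hs₁ : s ≠ 1 := fun h ↦ by simp [h] at hs
    rw [(LSeriesHasSum_biquadraticMul χ ψ hs).LSeries_eq, hWdef]
    simp only [LFunctionTrivChar₁, Function.update_of_ne hs₁, LFunctionTrivChar, LFunction_modOne_eq]
    ring
  have hL {θ : DirichletCharacter ℂ N} (hθ : θ ≠ 1) {z : ℂ} (hz : 1 / 2 ≤ z.re) (hz' : ‖z‖ ≤ 7 / 2) :
      ‖LFunction θ z‖ ≤ 7 * N := by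
    refine (norm_LFunction_le hθ (δ := 1 / 2) (by norm_num) le_rfl (by linarith)).trans ?_
    calc ‖z‖ * ((N : ℝ) ^ (2 * (1 / 2 : ℝ)) / (1 / 2)) ≤ 7 / 2 * ((N : ℝ) ^ (2 * (1 / 2 : ℝ)) / (1 / 2)) := by
          gcongr
      _ = 7 * N := by norm_num; ring
  have hprod {z : ℂ} (hz : 1 / 2 ≤ z.re) (hz' : ‖z‖ ≤ 7 / 2) :
      ‖LFunction χ z * (LFunction ψ z * LFunction (χ * ψ) z)‖ ≤ 343 * (N : ℝ) ^ 3 := by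
    rw [norm_mul, norm_mul]
    calc _ ≤ (7 * N : ℝ) * (7 * N * (7 * N)) := by
          gcongr
          exacts [hL hχ₁ hz hz', hL hψ₁ hz hz', hL hχψ hz hz']
      _ = _ := by ring
  have hB (z : ℂ) (hz : z ∈ Metric.sphere (2 : ℂ) (3 / 2)) :
      ‖dslope W 1 z‖ ≤ 2 * (K + 1) * 343 * (N : ℝ) ^ 3 := by
    have hz' : ‖z - 2‖ = 3 / 2 := by simpa [dist_eq_norm] using hz
    have h₁ : 1 / 2 ≤ ‖z - 1‖ := by
      have := norm_sub_le (z - 1) 1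
      rw [show z - 1 - 1 = z - 2 by ring, hz', norm_one] at this
      linarith
    have h₂ : ‖z‖ ≤ 7 / 2 := by
      have := norm_add_le (z - 2) 2
      rw [sub_add_cancel, hz', Complex.norm_ofNat] at this
      linarith
    have h₃ : 1 / 2 ≤ z.re := by
      have := (abs_le.mp (Complex.abs_re_le_norm (z - 2))).1
      rw [hz', Complex.sub_re, Complex.re_ofNat] at this
      linarith
    have hne : z ≠ 1 := fun h ↦ by norm_num [h] at h₁
    rw [dslope_of_ne _ hne, slope_def_field, norm_div, div_le_iff₀ (by linarith)]
    calc ‖W z - W 1‖ ≤ ‖W z‖ + ‖W 1‖ := norm_sub_le _ _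
      _ ≤ K * (343 * (N : ℝ) ^ 3) + 343 * (N : ℝ) ^ 3 := by
          refine add_le_add ?_ ?_
          · rw [hWdef, norm_mul]
            gcongr
            exacts [hK z hz, hprod h₃ h₂]
          · rw [hW₁]
            exact hprod (by norm_num) (by norm_num)
      _ = 2 * (K + 1) * 343 * (N : ℝ) ^ 3 * (1 / 2) := by ring
      _ ≤ _ := by gcongr
  have hWσ : W σ = 0 := by simp [hWdef, hzero]
  have hB₁ : 1 ≤ 2 * (K + 1) * 343 * (N : ℝ) ^ 3 := by
    have := one_le_pow₀ hN (n := 3)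
    nlinarith
  have key := one_sub_le_of_dslope_bound hW (biquadraticMul_nonneg hχ hψ)
    (abscissaOfAbsConv_biquadraticMul_lt χ ψ) (one_le_re_LSeries_biquadraticMul hχ hψ)
    hWa hB₁ hB hσ hσ₁ hWσ
  have hpow : (8 * (2 * (K + 1) * 343 * (N : ℝ) ^ 3)) ^ (4 * (1 - σ)) ≤
      D * (N : ℝ) ^ (12 * (1 - σ)) := by
    rw [← mul_assoc, Real.mul_rpow (by positivity) (by positivity), ← hD, ← Real.rpow_natCast,
      ← Real.rpow_mul (by positivity)]
    have : D ^ (4 * (1 - σ)) ≤ D := by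
      simpa using Real.rpow_le_rpow_of_exponent_le hD₁ (show 4 * (1 - σ) ≤ 1 by linarith)
    rw [show ((3 : ℕ) : ℝ) * (4 * (1 - σ)) = 12 * (1 - σ) by push_cast; ring]
    gcongr
  calc 1 - σ ≤ 6 * (D * (N : ℝ) ^ (12 * (1 - σ))) * ‖W 1‖ := key.trans (by gcongr)
    _ = _ := by rw [hW₁, norm_mul, norm_mul]; ring

lemma norm_LFunction_one_le_of_zero {χ : DirichletCharacter ℂ N} (hχ : χ ≠ 1) {δ : ℝ}
    (hδ₀ : 0 < δ) (hδ : δ ≤ 1 / 2) {β : ℝ} (hβ : 1 - δ / 2 ≤ β) (hβ₁ : β ≤ 1)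
    (hzero : LFunction χ β = 0) :
    ‖LFunction χ 1‖ ≤ 4 * (N : ℝ) ^ (2 * δ) / δ ^ 2 * (1 - β) := by
  have hd := differentiable_LFunction hχ
  have hderiv (w : ℂ) (hw : w ∈ Metric.closedBall (1 : ℂ) (δ / 2)) :
      ‖deriv (LFunction χ) w‖ ≤ 4 * (N : ℝ) ^ (2 * δ) / δ ^ 2 := by
    have hb : ∀ z ∈ Metric.sphere w (δ / 2), ‖LFunction χ z‖ ≤ 2 * ((N : ℝ) ^ (2 * δ) / δ) := by
      intro z hz
      have hz₁ : ‖z - 1‖ ≤ δ := by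
        have h₁ : ‖w - 1‖ ≤ δ / 2 := by simpa [dist_eq_norm] using hw
        have h₂ : ‖z - w‖ = δ / 2 := by simpa [dist_eq_norm] using hz
        have := norm_add_le (z - w) (w - 1)
        rw [sub_add_sub_cancel] at this
        linarith
      have hre : 1 - δ ≤ z.re := by
        have := (abs_le.mp ((Complex.abs_re_le_norm (z - 1)).trans hz₁)).1
        rw [Complex.sub_re, Complex.one_re] at this
        linarith
      have hnorm : ‖z‖ ≤ 2 := by
        have := norm_add_le (z - 1) 1
        rw [sub_add_cancel, norm_one] at this
        linarith
      exact (norm_LFunction_le hχ hδ₀ hδ hre).trans (by gcongr)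
    refine (Complex.norm_deriv_le_of_forall_mem_sphere_norm_le (by positivity)
      hd.diffContOnCl hb).trans (le_of_eq ?_)
    field_simp
    ring
  have hβ' : (β : ℂ) ∈ Metric.closedBall (1 : ℂ) (δ / 2) := by
    rw [mem_closedBall_iff_norm', ← Complex.ofReal_one, ← Complex.ofReal_sub, Complex.norm_real,
      Real.norm_of_nonneg (by linarith)]
    linarith
  have h := (convex_closedBall (1 : ℂ) (δ / 2)).norm_image_sub_le_of_norm_deriv_le
    (fun w _ ↦ hd w) hderiv hβ' (Metric.mem_closedBall_self (by positivity))
  rwa [hzero, sub_zero, ← Complex.ofReal_one, ← Complex.ofReal_sub, Complex.norm_real,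
    Real.norm_of_nonneg (by linarith), Complex.ofReal_one] at h

/-- Quantitative repulsion of the zeros close to `1` of two quadratic characters. -/
lemma exists_one_sub_zero_le_mul_one_sub_zero {δ : ℝ} (hδ₀ : 0 < δ) (hδ : δ ≤ 1 / 8) :
    ∃ C : ℝ, 0 < C ∧ ∀ (N : ℕ) [NeZero N] (χ ψ : DirichletCharacter ℂ N),
      χ ^ 2 = 1 → ψ ^ 2 = 1 → χ ≠ 1 → ψ ≠ 1 → χ * ψ ≠ 1 → ∀ β₁ β₂ : ℝ,
      1 - δ ≤ β₁ → β₁ < 1 → 1 - δ / 2 ≤ β₂ → β₂ ≤ 1 → LFunction χ β₁ = 0 → LFunction ψ β₂ = 0 →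
      1 - β₁ ≤ C * (N : ℝ) ^ (18 * δ) * (1 - β₂) := by
  obtain ⟨C, hC, h⟩ := exists_one_sub_zero_le
  refine ⟨C * 4 / δ ^ 4, by positivity, fun N _ χ ψ hχ hψ hχ₁ hψ₁ hχψ β₁ β₂ hβ₁ hβ₁' hβ₂ hβ₂'
    hz₁ hz₂ ↦ ?_⟩
  have hN : (1 : ℝ) ≤ N := by exact_mod_cast NeZero.one_le
  have hL {θ : DirichletCharacter ℂ N} (hθ : θ ≠ 1) :
      ‖LFunction θ 1‖ ≤ (N : ℝ) ^ (2 * δ) / δ := by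
    simpa using norm_LFunction_le hθ hδ₀ (by linarith) (s := 1) (by simpa using hδ₀.le)
  have hψ' := norm_LFunction_one_le_of_zero hψ₁ hδ₀ (by linarith) hβ₂ hβ₂' hz₂
  have hβ₂0 : 0 ≤ 1 - β₂ := by linarith
  calc 1 - β₁ ≤ C * (N : ℝ) ^ (12 * (1 - β₁)) *
      (‖LFunction χ 1‖ * ‖LFunction ψ 1‖ * ‖LFunction (χ * ψ) 1‖) :=
        h N χ ψ hχ hψ hχ₁ hψ₁ hχψ β₁ (by linarith) hβ₁' hz₁
    _ ≤ C * (N : ℝ) ^ (12 * δ) * ((N : ℝ) ^ (2 * δ) / δ *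
        (4 * (N : ℝ) ^ (2 * δ) / δ ^ 2 * (1 - β₂)) * ((N : ℝ) ^ (2 * δ) / δ)) := by
        gcongr
        exacts [by linarith, hL hχ₁, hL hχψ]
    _ = C * 4 / δ ^ 4 * ((N : ℝ) ^ (12 * δ) * ((N : ℝ) ^ (2 * δ) * (N : ℝ) ^ (2 * δ) *
        (N : ℝ) ^ (2 * δ))) * (1 - β₂) := by
        field_simp
    _ = _ := by
        have hN₀ : (0 : ℝ) < N := by linarith
        rw [← Real.rpow_add hN₀, ← Real.rpow_add hN₀, ← Real.rpow_add hN₀]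
        ring_nf

omit [NeZero N] in
lemma sq_eq_one_of_im_eq_zero {χ : DirichletCharacter ℂ N} (h : ∀ n, (χ n).im = 0) :
    χ ^ 2 = 1 := by
  ext a
  have h₁ := χ.unit_norm_eq_one a
  rw [MulChar.pow_apply_coe, MulChar.one_apply_coe]
  have h₂ : χ a = ((χ a).re : ℂ) := Complex.ext rfl (by simp [h])
  rw [h₂, Complex.norm_real, Real.norm_eq_abs] at h₁
  rw [h₂, ← Complex.ofReal_pow, ← sq_abs, h₁]
  simp

lemma IsPrimitive.ne_one {χ : DirichletCharacter ℂ N} (hχ : χ.IsPrimitive) (hN : N ≠ 1) :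
    χ ≠ 1 := by
  rintro rfl
  exact hN (hχ.symm.trans conductor_one)

lemma IsPrimitive.changeLevel_mul_changeLevel_ne_one {M₁ M₂ : ℕ} (h₁ : M₁ ∣ N) (h₂ : M₂ ∣ N)
    {χ₁ : DirichletCharacter ℂ M₁} {χ₂ : DirichletCharacter ℂ M₂} (hχ₁ : χ₁.IsPrimitive)
    (hχ₂ : χ₂.IsPrimitive) (hM : M₁ ≠ M₂) : changeLevel h₁ χ₁ * changeLevel h₂ χ₂ ≠ 1 := by
  intro h
  have := congr_arg conductor (eq_inv_of_mul_eq_one_left h)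
  rw [conductor_inv, conductor_changeLevel, conductor_changeLevel, hχ₁, hχ₂] at this
  exact hM this

lemma LFunction_changeLevel_eq_zero {M : ℕ} [NeZero M] (h : M ∣ N) {χ : DirichletCharacter ℂ M}
    (hχ : χ ≠ 1) {s : ℂ} (hs : LFunction χ s = 0) : LFunction (changeLevel h χ) s = 0 := by
  rw [LFunction_changeLevel h χ (Or.inl hχ), hs, zero_mul]

variable (N) in
lemma exists_forall_LFunction_ne_zero_near_one :
    ∃ η > 0, ∀ χ : DirichletCharacter ℂ N, χ ≠ 1 → ∀ β : ℝ, 1 - η < β → β ≤ 1 →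
      LFunction χ β ≠ 0 := by
  have h : ∀ᶠ s in 𝓝 (1 : ℂ), ∀ χ : DirichletCharacter ℂ N, χ ≠ 1 → LFunction χ s ≠ 0 := by
    refine eventually_all.mpr fun χ ↦ eventually_imp_distrib_left.mpr fun hχ ↦ ?_
    exact (differentiable_LFunction hχ).continuous.continuousAt.eventually_ne
      (LFunction_apply_one_ne_zero hχ)
  obtain ⟨η, hη, H⟩ := Metric.eventually_nhds_iff.mp h
  refine ⟨η, hη, fun χ hχ β hβ hβ₁ ↦ H ?_ χ hχ⟩
  rw [← Complex.ofReal_one, Complex.dist_of_im_eq (by simp), Complex.ofReal_re, Complex.ofReal_re,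
    Real.dist_eq, abs_lt]
  constructor <;> linarith

end DirichletCharacter

/-- (Siegel) For every `ε > 0` there is `c(ε) > 0` such that for every `Q ≥ 3` and every
primitive real-valued Dirichlet character `χ` modulo `Q`, every real zero `β` of
`L(s,χ)` satisfies `β < 1 − c(ε)/Q^ε`. -/
theorem siegel_real_zero_bound :
    ∀ ε : ℝ, 0 < ε → ∃ c : ℝ, 0 < c ∧
      ∀ (Q : ℕ) (hQ : 3 ≤ Q) (χ : DirichletCharacter ℂ Q),
        χ.IsPrimitive → (∀ n, (χ n).im = 0) →
        ∀ β : ℝ,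
          (haveI : NeZero Q := ⟨by omega⟩;
            DirichletCharacter.LFunction χ (β : ℂ) = 0) →
          β < 1 - c / (Q : ℝ) ^ ε := by
  intro ε hε
  set δ : ℝ := min (1 / 8) (ε / 18) with hδdef
  have hδ₀ : 0 < δ := by positivity
  have hδ₁ : δ ≤ 1 / 8 := min_le_left _ _
  have hδ₂ : 18 * δ ≤ ε := by linarith [min_le_right (1 / 8) (ε / 18)]
  have hQε {Q : ℕ} (hQ : 3 ≤ Q) : 1 ≤ (Q : ℝ) ^ ε :=
    Real.one_le_rpow (by exact_mod_cast (by omega : 1 ≤ Q)) hε.le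
  by_cases hex : ∃ (Q : ℕ) (hQ : 3 ≤ Q) (χ : DirichletCharacter ℂ Q) (β : ℝ),
      χ.IsPrimitive ∧ (∀ n, (χ n).im = 0) ∧
      (haveI : NeZero Q := ⟨by omega⟩; DirichletCharacter.LFunction χ (β : ℂ) = 0) ∧ 1 - δ ≤ β
  · obtain ⟨q, hq, χ₁, β₁, hprim₁, hreal₁, hz₁, hβ₁⟩ := hex
    have : NeZero q := ⟨by omega⟩
    have hχ₁ : χ₁ ≠ 1 := hprim₁.ne_one (by omega)
    have hβ₁' : β₁ < 1 := by
      by_contra! h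
      exact DirichletCharacter.LFunction_ne_zero_of_one_le_re χ₁ (Or.inl hχ₁) (by simpa using h) hz₁
    obtain ⟨η, hη, hnear⟩ := DirichletCharacter.exists_forall_LFunction_ne_zero_near_one q
    obtain ⟨C, hC, hrep⟩ :=
      DirichletCharacter.exists_one_sub_zero_le_mul_one_sub_zero hδ₀ hδ₁
    have hβ₁pos : 0 < 1 - β₁ := by linarith
    have hq₀ : (0 : ℝ) < q := by exact_mod_cast (by omega : 0 < q)
    set D : ℝ := C * (q : ℝ) ^ ε / (1 - β₁) with hD
    have hDpos : 0 < D := by positivity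
    set c : ℝ := min (δ / 4) (min (η / 2) (1 / (2 * D))) with hc
    have hcpos : 0 < c := by positivity
    have hc₁ : c ≤ δ / 4 := min_le_left _ _
    have hc₂ : c ≤ η / 2 := (min_le_right _ _).trans (min_le_left _ _)
    have hc₃ : c ≤ 1 / (2 * D) := (min_le_right _ _).trans (min_le_right _ _)
    refine ⟨c, hcpos, fun Q hQ χ hprim hreal β hz ↦ ?_⟩
    have : NeZero Q := ⟨by omega⟩
    have hχ : χ ≠ 1 := hprim.ne_one (by omega)
    have hβ' : β < 1 := by
      by_contra! h
      exact DirichletCharacter.LFunction_ne_zero_of_one_le_re χ (Or.inl hχ) (by simpa using h) hz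
    have hcQ : c / (Q : ℝ) ^ ε ≤ c := div_le_self hcpos.le (hQε hQ)
    rcases lt_or_ge β (1 - δ / 2) with hβ | hβ
    · linarith
    rcases eq_or_ne q Q with rfl | hne
    · have : β ≤ 1 - η := by
        by_contra! h
        exact hnear χ hχ β h hβ'.le hz
      linarith
    have : NeZero (q * Q) := ⟨mul_ne_zero (NeZero.ne q) (NeZero.ne Q)⟩
    have h₁ : q ∣ q * Q := dvd_mul_right _ _
    have h₂ : Q ∣ q * Q := dvd_mul_left _ _
    have hsq {M : ℕ} (h : M ∣ q * Q) {θ : DirichletCharacter ℂ M}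
        (hθ : ∀ n, (θ n).im = 0) : DirichletCharacter.changeLevel h θ ^ 2 = 1 := by
      rw [← map_pow, DirichletCharacter.sq_eq_one_of_im_eq_zero hθ, map_one]
    have key := hrep (q * Q) _ _ (hsq h₁ hreal₁) (hsq h₂ hreal)
      (mt (DirichletCharacter.changeLevel_eq_one_iff h₁).mp hχ₁)
      (mt (DirichletCharacter.changeLevel_eq_one_iff h₂).mp hχ)
      (hprim₁.changeLevel_mul_changeLevel_ne_one h₁ h₂ hprim hne) β₁ β hβ₁ hβ₁' hβ hβ'.le
      (DirichletCharacter.LFunction_changeLevel_eq_zero h₁ hχ₁ hz₁)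
      (DirichletCharacter.LFunction_changeLevel_eq_zero h₂ hχ hz)
    have hQpos : 0 < (Q : ℝ) ^ ε := by linarith [hQε hQ]
    have hβpos : 0 < 1 - β := by linarith
    have hkey : 1 ≤ D * (Q : ℝ) ^ ε * (1 - β) := by
      have : 1 - β₁ ≤ C * ((q : ℝ) ^ ε * (Q : ℝ) ^ ε) * (1 - β) := by
        refine key.trans ?_
        rw [← Real.mul_rpow hq₀.le (by positivity), ← Nat.cast_mul]
        gcongr
        exact_mod_cast NeZero.one_le
      rw [hD, div_mul_eq_mul_div, div_mul_eq_mul_div, le_div_iff₀ hβ₁pos]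
      linarith
    have hlt : c / (Q : ℝ) ^ ε < 1 - β := by
      rw [div_lt_iff₀ hQpos]
      refine hc₃.trans_lt ?_
      rw [div_lt_iff₀ (by positivity)]
      linarith
    linarith
  · push Not at hex
    refine ⟨δ, hδ₀, fun Q hQ χ hprim hreal β hz ↦ ?_⟩
    have h := hex Q hQ χ β hprim hreal hz
    have : δ / (Q : ℝ) ^ ε ≤ δ := div_le_self hδ₀.le (hQε hQ)
    linarith
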